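/- arXiv:1907.05670 — 4 statements merged into one kernel-verified Lean document; each statement's English description precedes it below -/
import Mathlib

section
/- A linear map γ : V₀ → C satisfies γ ∘ ∂ = 0 and ∂ ∘ γ = 0 if and only if γ = ι ∘ h ∘ π for a (necessarily unique) linear map h : coker ∂ → ker ∂. Consequently, the assignment h ↦ ι ∘ h ∘ π is a linear isomorphism from Hom(coker ∂, ker ∂) onto ker δ₀; in other words, the degree −1 cohomology of the normalized linear deformation complex of the 2-vector space is H⁻¹ = Hom(coker ∂, ker ∂). -/
/-! Degree −1 linear deformation cohomology of a 2-vector space determined by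
a linear map `d = ∂ : C → V₀`: `H⁻¹ = Hom(coker ∂, ker ∂)`. -/

variable {k C V₀ : Type*} [Field k] [AddCommGroup C] [Module k C]
  [AddCommGroup V₀] [Module k V₀]

/-- The differential `δ₀ : Hom(V₀, C) → End(C) × End(V₀)`,
`δ₀(γ) = (γ ∘ ∂, ∂ ∘ γ)`. -/
def delta0 (d : C →ₗ[k] V₀) :
    (V₀ →ₗ[k] C) →ₗ[k] Module.End k C × Module.End k V₀ where
  toFun γ := (γ ∘ₗ d, d ∘ₗ γ)
  map_add' a b := by
    simp [Prod.ext_iff, LinearMap.add_comp, LinearMap.comp_add]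
  map_smul' r a := by
    simp [Prod.ext_iff, LinearMap.smul_comp, LinearMap.comp_smul]

/-- Any composite `ι ∘ h ∘ π` is killed by both compositions with `d`. -/
theorem aux_zero (d : C →ₗ[k] V₀) (h : (V₀ ⧸ LinearMap.range d) →ₗ[k] LinearMap.ker d) :
    ((LinearMap.ker d).subtype ∘ₗ h ∘ₗ (LinearMap.range d).mkQ) ∘ₗ d = 0 ∧
      d ∘ₗ ((LinearMap.ker d).subtype ∘ₗ h ∘ₗ (LinearMap.range d).mkQ) = 0 := by
  constructor
  · ext c
    have : (LinearMap.range d).mkQ (d c) = 0 := by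
      rw [Submodule.mkQ_apply, Submodule.Quotient.mk_eq_zero]
      exact ⟨c, rfl⟩
    simp only [LinearMap.comp_apply, this, map_zero, LinearMap.zero_apply]
  · ext v
    exact (h ((LinearMap.range d).mkQ v)).2

theorem aux_inj (d : C →ₗ[k] V₀) (h h' : (V₀ ⧸ LinearMap.range d) →ₗ[k] LinearMap.ker d)
    (e : (LinearMap.ker d).subtype ∘ₗ h ∘ₗ (LinearMap.range d).mkQ =
      (LinearMap.ker d).subtype ∘ₗ h' ∘ₗ (LinearMap.range d).mkQ) : h = h' := by
  apply LinearMap.ext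
  intro x
  obtain ⟨v, rfl⟩ := (LinearMap.range d).mkQ_surjective x
  exact Subtype.ext (LinearMap.congr_fun e v)

theorem aux_ex (d : C →ₗ[k] V₀) (γ : V₀ →ₗ[k] C) (h1 : γ ∘ₗ d = 0) (h2 : d ∘ₗ γ = 0) :
    ∃ h : (V₀ ⧸ LinearMap.range d) →ₗ[k] LinearMap.ker d,
      γ = (LinearMap.ker d).subtype ∘ₗ h ∘ₗ (LinearMap.range d).mkQ := by
  refine ⟨(LinearMap.range d).liftQ
    (γ.codRestrict (LinearMap.ker d) (fun v => LinearMap.congr_fun h2 v)) ?_, ?_⟩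
  · rintro _ ⟨c, rfl⟩
    exact Subtype.ext (LinearMap.congr_fun h1 c)
  · ext v
    rfl

/-- A linear map `γ : V₀ → C` satisfies `γ ∘ ∂ = 0` and `∂ ∘ γ = 0` iff it factors
(uniquely) as `ι ∘ h ∘ π` through a linear map `h : coker ∂ → ker ∂`; consequently
`Hom(coker ∂, ker ∂) ≅ ker δ₀`, i.e. `H⁻¹ = Hom(coker ∂, ker ∂)`. -/
theorem stmt0 (d : C →ₗ[k] V₀) :
    (∀ γ : V₀ →ₗ[k] C,
      (γ ∘ₗ d = 0 ∧ d ∘ₗ γ = 0) ↔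
        ∃! h : (V₀ ⧸ LinearMap.range d) →ₗ[k] LinearMap.ker d,
          γ = (LinearMap.ker d).subtype ∘ₗ h ∘ₗ (LinearMap.range d).mkQ) ∧
    ∃ e : ((V₀ ⧸ LinearMap.range d) →ₗ[k] LinearMap.ker d) ≃ₗ[k]
        LinearMap.ker (delta0 d),
      ∀ h : (V₀ ⧸ LinearMap.range d) →ₗ[k] LinearMap.ker d,
        ((e h : V₀ →ₗ[k] C)) =
          (LinearMap.ker d).subtype ∘ₗ h ∘ₗ (LinearMap.range d).mkQ := by
  refine ⟨fun γ => ⟨?_, ?_⟩, ?_⟩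
  · rintro ⟨h1, h2⟩
    obtain ⟨h, hh⟩ := aux_ex d γ h1 h2
    exact ⟨h, hh, fun h' hh' => aux_inj d h' h (hh'.symm.trans hh)⟩
  · rintro ⟨h, rfl, -⟩
    exact aux_zero d h
  · let f : ((V₀ ⧸ LinearMap.range d) →ₗ[k] LinearMap.ker d) →ₗ[k]
        LinearMap.ker (delta0 d) :=
      { toFun := fun h => ⟨(LinearMap.ker d).subtype ∘ₗ h ∘ₗ (LinearMap.range d).mkQ,
          LinearMap.mem_ker.2 (Prod.ext (aux_zero d h).1 (aux_zero d h).2)⟩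
        map_add' := fun a b => by
          apply Subtype.ext
          ext v
          rfl
        map_smul' := fun r a => by
          apply Subtype.ext
          ext v
          rfl }
    refine ⟨LinearEquiv.ofBijective f ⟨?_, ?_⟩, fun h => rfl⟩
    · intro a b hab
      exact aux_inj d a b (congrArg Subtype.val hab)
    · rintro ⟨γ, hγ⟩
      have hγ' := LinearMap.mem_ker.1 hγ
      obtain ⟨h, hh⟩ := aux_ex d γ (congrArg Prod.fst hγ') (congrArg Prod.snd hγ')
      exact ⟨h, Subtype.ext hh.symm⟩
end

section
/- Let (γ₁, γ₂) ∈ End(C) × End(V₀) satisfy ∂ ∘ γ₁ = γ₂ ∘ ∂. Then there exists a linear map γ : V₀ → C with γ₁ = γ ∘ ∂ and γ₂ = ∂ ∘ γ (i.e. (γ₁, γ₂) ∈ range δ₀) if and only if γ₁ vanishes on ker ∂ and range γ₂ ⊆ range ∂. -/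
/-! Characterization of `range δ₀` inside `ker δ₁`: a pair `(γ₁, γ₂)` with
`∂ ∘ γ₁ = γ₂ ∘ ∂` is of the form `(γ ∘ ∂, ∂ ∘ γ)` for some linear `γ : V₀ → C`
iff `γ₁` vanishes on `ker ∂` and `range γ₂ ⊆ range ∂`. -/

variable {k C V₀ : Type*} [Field k] [AddCommGroup C] [Module k C]
  [AddCommGroup V₀] [Module k V₀]

theorem stmt2 (d : C →ₗ[k] V₀) (γ₁ : Module.End k C) (γ₂ : Module.End k V₀)
    (h : d ∘ₗ γ₁ = γ₂ ∘ₗ d) :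
    (∃ γ : V₀ →ₗ[k] C, γ₁ = γ ∘ₗ d ∧ γ₂ = d ∘ₗ γ) ↔
      ((∀ x ∈ LinearMap.ker d, γ₁ x = 0) ∧
        LinearMap.range γ₂ ≤ LinearMap.range d) := by
  constructor
  · rintro ⟨γ, rfl, rfl⟩
    refine ⟨fun x hx => ?_, ?_⟩
    · rw [LinearMap.mem_ker] at hx
      simp [hx]
    · rintro _ ⟨x, rfl⟩
      exact ⟨γ x, rfl⟩
  · rintro ⟨h1, h2⟩
    obtain ⟨s, hs⟩ := d.rangeRestrict.exists_rightInverse_of_surjective d.range_rangeRestrict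
    obtain ⟨g, hg⟩ := LinearMap.exists_extend s
    have key : ∀ x, d (g (d x)) = d x := by
      intro x
      have e1 : g (d x) = s ⟨d x, x, rfl⟩ := LinearMap.congr_fun hg ⟨d x, x, rfl⟩
      have e2 := congrArg Subtype.val (LinearMap.congr_fun hs ⟨d x, x, rfl⟩)
      rw [e1]
      exact e2
    have hh : ∀ x, d (γ₁ x) = γ₂ (d x) := fun x => LinearMap.congr_fun h x
    refine ⟨γ₁ ∘ₗ g + g ∘ₗ γ₂ ∘ₗ (LinearMap.id - d ∘ₗ g), ?_, ?_⟩
    · ext x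
      have e := h1 (x - g (d x)) (by simp [key])
      rw [map_sub, sub_eq_zero] at e
      simp [key, ← e]
    · ext v
      obtain ⟨y, hy⟩ := h2 ⟨v - d (g v), rfl⟩
      have e : d (g (γ₂ (v - d (g v)))) = γ₂ (v - d (g v)) := by rw [← hy, key]
      simp only [LinearMap.comp_apply, LinearMap.add_apply, LinearMap.sub_apply,
        LinearMap.id_apply, map_add, hh]
      rw [e, ← map_add]
      simp
end

section
/- The linear map Φ : ker δ₁ → End(ker ∂) × End(coker ∂), Φ(γ₁, γ₂) = (γ̄₁, γ̄₂), is surjective and its kernel is exactly range δ₀. Consequently Φ induces a linear isomorphism H⁰ := ker δ₁ / range δ₀ ≅ End(ker ∂) × End(coker ∂); this computes the degree 0 linear deformation cohomology of the 2-vector space determined by ∂. -/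
/-! Degree 0 linear deformation cohomology of a 2-vector space:
`H⁰ = ker δ₁ / range δ₀ ≅ End(ker ∂) × End(coker ∂)`. -/

variable {k C V₀ : Type*} [Field k] [AddCommGroup C] [Module k C]
  [AddCommGroup V₀] [Module k V₀]

/-- The differential `δ₁ : End(C) × End(V₀) → Hom(C, V₀)`,
`δ₁(γ₁, γ₂) = γ₂ ∘ ∂ − ∂ ∘ γ₁`. -/
def delta1 (d : C →ₗ[k] V₀) :
    (Module.End k C × Module.End k V₀) →ₗ[k] (C →ₗ[k] V₀) where
  toFun γ := γ.2 ∘ₗ d - d ∘ₗ γ.1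
  map_add' a b := by
    ext x
    simp [LinearMap.add_comp, LinearMap.comp_add]
    abel
  map_smul' r a := by
    ext x
    simp [LinearMap.smul_comp, LinearMap.comp_smul, smul_sub]

theorem mem_ker_delta1 (d : C →ₗ[k] V₀) (γ : LinearMap.ker (delta1 d)) (x : C) :
    γ.1.2 (d x) = d (γ.1.1 x) := by
  have h : delta1 d γ.1 = 0 := γ.2
  have h2 := LinearMap.congr_fun h x
  exact sub_eq_zero.mp h2

/-- The map Φ. -/
def PhiMap (d : C →ₗ[k] V₀) : LinearMap.ker (delta1 d) →ₗ[k]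
    Module.End k (LinearMap.ker d) × Module.End k (V₀ ⧸ LinearMap.range d) where
  toFun γ := (γ.1.1.restrict (p := LinearMap.ker d) (q := LinearMap.ker d) (by
      intro x hx
      rw [LinearMap.mem_ker] at hx ⊢
      rw [← mem_ker_delta1, hx, map_zero]),
    Submodule.mapQ _ _ γ.1.2 (by
      rintro _ ⟨x, rfl⟩
      exact ⟨γ.1.1 x, (mem_ker_delta1 d γ x).symm⟩))
  map_add' a b := by
    refine Prod.ext ?_ ?_
    · ext x; rfl
    · ext x; rfl
  map_smul' r a := by
    refine Prod.ext ?_ ?_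
    · ext x; rfl
    · ext x; rfl

theorem PhiMap_fst (d : C →ₗ[k] V₀) (γ : LinearMap.ker (delta1 d)) (x : LinearMap.ker d) :
    (((PhiMap d γ).1 x : LinearMap.ker d) : C) = γ.1.1 x := rfl

theorem PhiMap_snd (d : C →ₗ[k] V₀) (γ : LinearMap.ker (delta1 d)) (x : V₀) :
    (PhiMap d γ).2 ((LinearMap.range d).mkQ x) = (LinearMap.range d).mkQ (γ.1.2 x) := rfl

theorem PhiMap_surj (d : C →ₗ[k] V₀) : Function.Surjective (PhiMap d) := by
  rintro ⟨a, b⟩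
  obtain ⟨r, hr⟩ := (LinearMap.ker d).subtype.exists_leftInverse_of_injective
    (Submodule.ker_subtype _)
  obtain ⟨t, ht⟩ := (LinearMap.range d).mkQ.exists_rightInverse_of_surjective
    (Submodule.range_mkQ _)
  refine ⟨⟨((LinearMap.ker d).subtype ∘ₗ a ∘ₗ r, t ∘ₗ b ∘ₗ (LinearMap.range d).mkQ), ?_⟩, ?_⟩
  · rw [LinearMap.mem_ker]
    ext x
    have h1 : (LinearMap.range d).mkQ (d x) = 0 := by simp
    have h2 : d ((a (r x) : LinearMap.ker d) : C) = 0 := (a (r x)).2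
    change t (b ((LinearMap.range d).mkQ (d x))) - d ((a (r x) : LinearMap.ker d) : C) = 0
    rw [h1, h2]; simp
  · refine Prod.ext ?_ ?_
    · refine LinearMap.ext fun x => Subtype.ext ?_
      rw [PhiMap_fst]
      have h := LinearMap.congr_fun hr x
      change ((a (r x) : LinearMap.ker d) : C) = a x
      exact congrArg (fun y => ((a y : LinearMap.ker d) : C)) h
    · refine LinearMap.ext fun x => ?_
      obtain ⟨x, rfl⟩ := Submodule.mkQ_surjective _ x
      rw [PhiMap_snd]
      exact LinearMap.congr_fun ht _

theorem PhiMap_ker (d : C →ₗ[k] V₀) : LinearMap.ker (PhiMap d) =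
    (LinearMap.range (delta0 d)).comap (LinearMap.ker (delta1 d)).subtype := by
  ext γ
  rw [LinearMap.mem_ker, Submodule.mem_comap]
  constructor
  · intro h
    have h1 : ∀ x, d x = 0 → γ.1.1 x = 0 := by
      intro x hx
      have := PhiMap_fst d γ ⟨x, hx⟩
      rw [h] at this
      exact this.symm
    have h2 : ∀ x, γ.1.2 x ∈ LinearMap.range d := by
      intro x
      have := PhiMap_snd d γ x
      rw [h] at this
      exact (Submodule.Quotient.mk_eq_zero _).mp this.symm
    obtain ⟨s0, hs0⟩ := d.rangeRestrict.exists_rightInverse_of_surjective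
      (LinearMap.range_rangeRestrict d)
    obtain ⟨s, hs⟩ := LinearMap.exists_extend s0
    have hd : ∀ y ∈ LinearMap.range d, d (s y) = y := by
      intro y hy
      have e1 : s y = s0 ⟨y, hy⟩ := LinearMap.congr_fun hs ⟨y, hy⟩
      have e2 := congrArg Subtype.val (LinearMap.congr_fun hs0 ⟨y, hy⟩)
      rw [e1]; exact e2
    refine ⟨γ.1.1 ∘ₗ s + s ∘ₗ γ.1.2 ∘ₗ (LinearMap.id - d ∘ₗ s), ?_⟩
    refine Prod.ext ?_ ?_
    · refine LinearMap.ext fun x => ?_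
      change γ.1.1 (s (d x)) + s (γ.1.2 (d x - d (s (d x)))) = γ.1.1 x
      have h3 := h1 (s (d x) - x) (by rw [map_sub, hd _ ⟨x, rfl⟩, sub_self])
      rw [map_sub, sub_eq_zero] at h3
      rw [hd _ ⟨x, rfl⟩, h3]; simp
    · refine LinearMap.ext fun x => ?_
      change d (γ.1.1 (s x) + s (γ.1.2 (x - d (s x)))) = γ.1.2 x
      rw [map_add, hd _ (h2 _), ← mem_ker_delta1, map_sub]; abel
  · rintro ⟨g, hg⟩
    have e1 : ∀ x, γ.1.1 x = g (d x) := fun x =>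
      (LinearMap.congr_fun (congrArg Prod.fst hg) x).symm
    have e2 : ∀ x, γ.1.2 x = d (g x) := fun x =>
      (LinearMap.congr_fun (congrArg Prod.snd hg) x).symm
    refine Prod.ext ?_ ?_
    · refine LinearMap.ext fun x => Subtype.ext ?_
      rw [PhiMap_fst, e1, show d x = 0 from x.2, map_zero]; rfl
    · refine LinearMap.ext fun x => ?_
      obtain ⟨x, rfl⟩ := Submodule.mkQ_surjective _ x
      rw [PhiMap_snd, e2]
      exact (Submodule.Quotient.mk_eq_zero _).mpr ⟨g x, rfl⟩

/-- The map `Φ : ker δ₁ → End(ker ∂) × End(coker ∂)`, `(γ₁, γ₂) ↦ (γ̄₁, γ̄₂)`,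
is surjective with kernel `range δ₀`, hence induces an isomorphism
`H⁰ = ker δ₁ / range δ₀ ≅ End(ker ∂) × End(coker ∂)`. -/
theorem stmt4 (d : C →ₗ[k] V₀) :
    ∃ Φ : LinearMap.ker (delta1 d) →ₗ[k]
        Module.End k (LinearMap.ker d) × Module.End k (V₀ ⧸ LinearMap.range d),
      (∀ γ : LinearMap.ker (delta1 d),
        (LinearMap.ker d).subtype ∘ₗ (Φ γ).1 =
          ((γ : Module.End k C × Module.End k V₀)).1 ∘ₗ (LinearMap.ker d).subtype ∧
        (Φ γ).2 ∘ₗ (LinearMap.range d).mkQ =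
          (LinearMap.range d).mkQ ∘ₗ ((γ : Module.End k C × Module.End k V₀)).2) ∧
      Function.Surjective Φ ∧
      LinearMap.ker Φ =
        (LinearMap.range (delta0 d)).comap (LinearMap.ker (delta1 d)).subtype ∧
      ∃ e : (LinearMap.ker (delta1 d) ⧸
              (LinearMap.range (delta0 d)).comap (LinearMap.ker (delta1 d)).subtype)
            ≃ₗ[k]
            Module.End k (LinearMap.ker d) × Module.End k (V₀ ⧸ LinearMap.range d),
        ∀ γ : LinearMap.ker (delta1 d), e (Submodule.Quotient.mk γ) = Φ γ := by
  refine ⟨PhiMap d, fun γ => ⟨rfl, rfl⟩, PhiMap_surj d, PhiMap_ker d, ?_⟩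
  refine ⟨(Submodule.quotEquivOfEq _ _ (PhiMap_ker d).symm).trans
    ((PhiMap d).quotKerEquivOfSurjective (PhiMap_surj d)), fun γ => rfl⟩
end

section
/- The map δ squares to zero: for every n ≥ 0 and every γ = (γ₁, γ₂) ∈ Dⁿ one has δ(δγ) = 0 in Dⁿ⁺². Hence (D•, δ) is a cochain complex (the explicit form of the linear deformation complex of the 2-vector space determined by ∂). -/
/-! The explicit linear deformation complex of the 2-vector space determined by
`∂ : C → V₀`: the differential `δ` squares to zero. -/

variable {k C V₀ : Type*} [Field k] [AddCommGroup C] [Module k C]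
  [AddCommGroup V₀] [Module k V₀]

/-- Merge the entries at (0-indexed) positions `p` and `p+1` of a tuple. -/
def contract {m : ℕ} (c : Fin (m + 1) → C) (p : ℕ) : Fin m → C :=
  fun j =>
    if (j : ℕ) < p then c j.castSucc
    else if (j : ℕ) = p then c j.castSucc + c j.succ
    else c j.succ

/-- The first component of the differential:
`(δγ)₁(c₀, …, c_{n+1}, v) = −γ₁(c₀, 0, …, 0, 0)
  + Σ_{i=1}^{n} (−1)^{i−1} γ₁(c₀, …, c_i + c_{i+1}, …, c_{n+1}, v)
  + (−1)ⁿ γ₁(c₀, …, c_n, ∂c_{n+1} + v)`. -/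
def dOne (d : C →ₗ[k] V₀) (n : ℕ) (γ₁ : (Fin (n + 1) → C) × V₀ → C) :
    (Fin (n + 2) → C) × V₀ → C := fun p =>
  -γ₁ ((fun j => if j = 0 then p.1 0 else 0), 0)
    + ∑ i ∈ Finset.range n, (-1 : k) ^ i • γ₁ (contract p.1 (i + 1), p.2)
    + (-1 : k) ^ n • γ₁ (Fin.init p.1, d (p.1 (Fin.last (n + 1))) + p.2)

/-- The second component of the differential:
`(δγ)₂(c₁, …, c_{n+1}, v) = −∂(γ₁(c₁, …, c_{n+1}, v)) − γ₂(c₂, …, c_{n+1}, v)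
  + Σ_{i=1}^{n} (−1)^{i−1} γ₂(c₁, …, c_i + c_{i+1}, …, c_{n+1}, v)
  + (−1)ⁿ γ₂(c₁, …, c_n, ∂c_{n+1} + v)`. -/
def dTwo (d : C →ₗ[k] V₀) (n : ℕ) (γ₁ : (Fin (n + 1) → C) × V₀ → C)
    (γ₂ : (Fin n → C) × V₀ → V₀) : (Fin (n + 1) → C) × V₀ → V₀ := fun p =>
  -d (γ₁ p) - γ₂ (Fin.tail p.1, p.2)
    + ∑ i ∈ Finset.range n, (-1 : k) ^ i • γ₂ (contract p.1 i, p.2)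
    + (-1 : k) ^ n • γ₂ (Fin.init p.1, d (p.1 (Fin.last n)) + p.2)


theorem alt_sum_zero {M : Type*} [AddCommGroup M] [Module k M] (a : ℕ → ℕ → M) (N : ℕ)
    (h : ∀ i j, i ≤ j → j ≤ N → a i (j + 1) = a j i) :
    ∑ j ∈ Finset.range (N + 2), (-1 : k) ^ j •
      ∑ i ∈ Finset.range (N + 1), (-1 : k) ^ i • a i j = 0 := by
  induction N with
  | zero => simp [Finset.sum_range_succ, h 0 0]
  | succ N ih =>
    have ih' := ih (fun i j hij hj => h i j hij (by omega))
    have hs : ∀ j, ∑ i ∈ Finset.range (N + 1 + 1), (-1 : k) ^ i • a i j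
        = ∑ i ∈ Finset.range (N + 1), (-1 : k) ^ i • a i j + (-1 : k) ^ (N + 1) • a (N + 1) j :=
      fun j => Finset.sum_range_succ _ _
    rw [Finset.sum_range_succ, hs (N + 1 + 1)]
    simp only [hs, smul_add, Finset.sum_add_distrib]
    rw [ih', zero_add, Finset.smul_sum]
    have e1 : ∑ j ∈ Finset.range (N + 2), (-1 : k) ^ j • (-1 : k) ^ (N + 1) • a (N + 1) j
        = - ∑ i ∈ Finset.range (N + 2), (-1 : k) ^ (N + 2) • (-1 : k) ^ i • a i (N + 2) := by
      rw [← Finset.sum_neg_distrib]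
      refine Finset.sum_congr rfl fun i hi => ?_
      rw [Finset.mem_range] at hi
      rw [h i (N + 1) (by omega) le_rfl, smul_smul, smul_smul, ← neg_smul]
      congr 1
      ring
    rw [e1, Finset.sum_range_succ _ (N + 1)]
    exact neg_add_cancel _

/-- nerve face -/
def face (d : C →ₗ[k] V₀) (n i : ℕ) (p : (Fin (n + 1) → C) × V₀) : (Fin n → C) × V₀ :=
  (fun j => if (j : ℕ) + 1 < i then p.1 j.castSucc
    else if (j : ℕ) + 1 = i then p.1 j.castSucc + p.1 j.succ else p.1 j.succ,
   if i ≤ n then p.2 else d (p.1 (Fin.last n)) + p.2)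

theorem face_zero (d : C →ₗ[k] V₀) (n : ℕ) (p : (Fin (n + 1) → C) × V₀) :
    face d n 0 p = (Fin.tail p.1, p.2) := by
  simp [face, Fin.tail, funext_iff]

theorem face_succ (d : C →ₗ[k] V₀) (n i : ℕ) (hi : i < n) (p : (Fin (n + 1) → C) × V₀) :
    face d n (i + 1) p = (contract p.1 i, p.2) := by
  have : i + 1 ≤ n := hi
  simp [face, contract, funext_iff, this]

theorem face_last (d : C →ₗ[k] V₀) (n : ℕ) (p : (Fin (n + 1) → C) × V₀) :
    face d n (n + 1) p = (Fin.init p.1, d (p.1 (Fin.last n)) + p.2) := by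
  simp [face, Fin.init, funext_iff]

theorem face_face (d : C →ₗ[k] V₀) (n i j : ℕ) (hij : i ≤ j) (hj : j ≤ n + 1)
    (p : (Fin (n + 2) → C) × V₀) :
    face d n i (face d (n + 1) (j + 1) p) = face d n j (face d (n + 1) i p) := by
  obtain ⟨c, v⟩ := p
  refine Prod.ext ?_ ?_
  · funext x
    simp only [face, Fin.val_castSucc, Fin.val_succ, Fin.castSucc_succ]
    split_ifs <;> first | rfl | omega | (simp only [Fin.succ_castSucc]; done) | abel
  · simp only [face, Fin.val_last, Fin.succ_last]
    split_ifs <;> first | rfl | omega | (simp only [map_add]; abel)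

/-- faces for the first component -/
def faceOne (d : C →ₗ[k] V₀) (n i : ℕ) (p : (Fin (n + 2) → C) × V₀) :
    (Fin (n + 1) → C) × V₀ :=
  if i = 0 then ((fun j => if j = 0 then p.1 0 else 0), 0) else face d (n + 1) (i + 1) p

theorem faceOne_faceOne (d : C →ₗ[k] V₀) (n i j : ℕ) (hij : i ≤ j) (hj : j ≤ n + 1)
    (p : (Fin (n + 3) → C) × V₀) :
    faceOne d n i (faceOne d (n + 1) (j + 1) p) = faceOne d n j (faceOne d (n + 1) i p) := by
  by_cases hi : i = 0
  · subst hi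
    by_cases h0 : j = 0
    · subst h0
      simp [faceOne, face]
    · have h1 : 0 < j := by omega
      simp only [faceOne, face, h0, if_true, if_false]
      refine Prod.ext ?_ ?_
      · funext x
        by_cases hx : x = 0
        · subst hx
          simp [h1, h0]
        · simp [hx]
      · simp [Fin.ext_iff]
  · have hj0 : j ≠ 0 := by omega
    simp only [faceOne, hi, hj0, if_false, Nat.succ_ne_zero, Nat.add_eq_zero_iff, false_and]
    exact face_face d (n + 1) (i + 1) (j + 1) (by omega) (by omega) p

theorem dOne_eq (d : C →ₗ[k] V₀) (n : ℕ) (g : (Fin (n + 1) → C) × V₀ → C)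
    (p : (Fin (n + 2) → C) × V₀) :
    dOne d n g p = - ∑ i ∈ Finset.range (n + 2), (-1 : k) ^ i • g (faceOne d n i p) := by
  rw [Finset.sum_range_succ, Finset.sum_range_succ']
  have e : ∑ i ∈ Finset.range n, (-1 : k) ^ (i + 1) • g (faceOne d n (i + 1) p)
      = - ∑ i ∈ Finset.range n, (-1 : k) ^ i • g (contract p.1 (i + 1), p.2) := by
    rw [← Finset.sum_neg_distrib]
    refine Finset.sum_congr rfl fun i hi => ?_
    rw [Finset.mem_range] at hi
    simp only [faceOne, Nat.succ_ne_zero, if_false]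
    rw [face_succ d (n + 1) (i + 1) (by omega), pow_succ]
    simp
  rw [e]
  have e2 : faceOne d n (n + 1) p = face d (n + 1) (n + 1 + 1) p := by simp [faceOne]
  rw [e2, face_last]
  simp only [dOne, faceOne, if_true, pow_succ, pow_zero, one_smul, mul_neg, mul_one, neg_smul]
  abel

theorem dTwo_eq (d : C →ₗ[k] V₀) (n : ℕ) (f : (Fin (n + 1) → C) × V₀ → C)
    (g : (Fin n → C) × V₀ → V₀) (p : (Fin (n + 1) → C) × V₀) :
    dTwo d n f g p = - d (f p)
      - ∑ i ∈ Finset.range (n + 2), (-1 : k) ^ i • g (face d n i p) := by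
  rw [Finset.sum_range_succ, Finset.sum_range_succ', face_last, face_zero]
  have e : ∑ i ∈ Finset.range n, (-1 : k) ^ (i + 1) • g (face d n (i + 1) p)
      = - ∑ i ∈ Finset.range n, (-1 : k) ^ i • g (contract p.1 i, p.2) := by
    rw [← Finset.sum_neg_distrib]
    refine Finset.sum_congr rfl fun i hi => ?_
    rw [Finset.mem_range] at hi
    rw [face_succ d n i hi, pow_succ]
    simp
  rw [e]
  simp only [dTwo, pow_succ, pow_zero, one_smul, mul_neg, mul_one, neg_smul]
  abel

theorem face_low (d : C →ₗ[k] V₀) (n : ℕ) (p : (Fin (n + 2) → C) × V₀) :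
    face d (n + 1) 1 p = faceOne d n 0 p + face d (n + 1) 0 p := by
  refine Prod.ext ?_ ?_
  · funext x
    by_cases hx : x = 0
    · subst hx
      simp [face, faceOne]
    · simp [face, faceOne, hx]
  · simp [face, faceOne]

/-- `δ ∘ δ = 0` on the explicit linear deformation complex: for every degree-`n`
cochain `γ = (γ₁, γ₂)` (a pair of linear maps), both components of `δ(δγ)`
vanish. -/
theorem stmt7 (d : C →ₗ[k] V₀) (n : ℕ)
    (γ₁ : ((Fin (n + 1) → C) × V₀) →ₗ[k] C)
    (γ₂ : ((Fin n → C) × V₀) →ₗ[k] V₀) :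
    dOne d (n + 1) (dOne d n ⇑γ₁) = 0 ∧
    dTwo d (n + 1) (dOne d n ⇑γ₁) (dTwo d n ⇑γ₁ ⇑γ₂) = 0 := by
  constructor
  · funext p
    rw [dOne_eq]
    simp only [dOne_eq, smul_neg, Finset.sum_neg_distrib, neg_neg, Pi.zero_apply]
    exact alt_sum_zero (fun i j => γ₁ (faceOne d n i (faceOne d (n + 1) j p))) (n + 1)
      (fun i j hij hj => by simp only [faceOne_faceOne d n i j hij hj p])
  · funext p
    have key := alt_sum_zero (k := k)
      (fun i j => γ₂ (face d n i (face d (n + 1) j p))) (n + 1)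
      (fun i j hij hj => by simp only [face_face d n i j hij hj p])
    rw [dTwo_eq]
    simp only [dOne_eq, dTwo_eq, smul_sub, Finset.sum_sub_distrib, Pi.zero_apply]
    rw [key, Finset.sum_range_succ' _ (n + 2), Finset.sum_range_succ' _ (n + 1),
      Finset.sum_range_succ' _ (n + 1)]
    have e : ∑ i ∈ Finset.range (n + 1), (-1 : k) ^ (i + 1 + 1) •
          -d (γ₁ (face d (n + 1) (i + 1 + 1) p))
        = d (∑ i ∈ Finset.range (n + 1), (-1 : k) ^ (i + 1) • γ₁ (faceOne d n (i + 1) p)) := by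
      rw [map_sum]
      refine Finset.sum_congr rfl fun i hi => ?_
      simp [faceOne, pow_succ]
    rw [e, face_low]
    simp only [map_add, map_neg, pow_succ, pow_zero, one_smul, mul_neg, mul_one, neg_smul,
      zero_add]
    abel
end
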